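/- Let d ≥ 1 and n ≥ d be integers. Let Y_1, …, Y_n be i.i.d. standard Gaussian random vectors in ℝ^d and let W := ∑_{i=1}^n Y_i Y_iᵀ. Then the law of the (1,1) entry of W⁻¹ equals the pushforward under the map u ↦ 1/u of the Gamma distribution with shape (n−d+1)/2 and scale 2 (i.e. the chi-squared distribution with n−d+1 degrees of freedom); in other words, (W⁻¹)_{11} is distributed as the reciprocal of a χ²_{n−d+1} random variable. -/

import Mathlib

open MeasureTheory ProbabilityTheory Matrix

/-- The law of `n` i.i.d. standard Gaussian vectors in `ℝ^d`. -/
noncomputable def stdGaussianSample (n d : ℕ) : Measure (Fin n → Fin d → ℝ) :=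
  Measure.pi fun _ => Measure.pi fun _ => gaussianReal 0 1

/-- Wishart matrix `W = ∑_{i=1}^n Y_i Y_iᵀ`. -/
noncomputable def wishart (n d : ℕ) (Y : Fin n → Fin d → ℝ) :
    Matrix (Fin d) (Fin d) ℝ :=
  ∑ i : Fin n, vecMulVec (Y i) (Y i)

lemma iw_mgf_sq (t : ℝ) :
    mgf (fun x : ℝ => x ^ 2) (gaussianReal 0 1) t = √((1 / 2) / (1 / 2 - t)) := by
  rw [mgf, integral_gaussianReal_eq_integral_smul one_ne_zero]
  have h : ∀ x : ℝ, gaussianPDFReal 0 1 x • Real.exp (t * x ^ 2)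
      = (√(2 * Real.pi))⁻¹ * Real.exp (-(1 / 2 - t) * x ^ 2) := by
    intro x
    simp only [gaussianPDFReal, smul_eq_mul, NNReal.coe_one, mul_one, sub_zero]
    rw [mul_assoc, ← Real.exp_add]
    congr 2
    ring
  simp_rw [h]
  rw [integral_const_mul, integral_gaussian, ← Real.sqrt_inv, ← Real.sqrt_mul (by positivity)]
  congr 1
  have := Real.pi_ne_zero
  by_cases h0 : 1 / 2 - t = 0
  · rw [h0]; simp
  · field_simp

lemma iw_mgf_gamma (k : ℕ) (hk : 0 < k) (t : ℝ) :
    mgf id (gammaMeasure ((k : ℝ) / 2) (1 / 2)) t = √((1 / 2) / (1 / 2 - t)) ^ k := by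
  have ha : 0 < (k : ℝ) / 2 := by positivity
  have hG := Real.Gamma_pos_of_pos ha
  set a : ℝ := (k : ℝ) / 2 with hadef
  have e1 : mgf id (gammaMeasure a (1 / 2)) t =
      ∫ x in Set.Ioi (0 : ℝ), ((1 / 2) ^ a / Real.Gamma a) *
        (x ^ (a - 1) * Real.exp (-((1 / 2 - t) * x))) := by
    have hmeas : Measurable (gammaPDF a (1 / 2)) := (measurable_gammaPDFReal _ _).ennreal_ofReal
    rw [mgf, gammaMeasure, integral_withDensity_eq_integral_toReal_smul
      hmeas (by simp [gammaPDF]),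
      ← integral_indicator measurableSet_Ioi]
    apply integral_congr_ae
    filter_upwards [(compl_mem_ae_iff.2 (by simp) : {(0 : ℝ)}ᶜ ∈ ae volume)] with x hx
    have hx : x ≠ 0 := hx
    simp only [gammaPDF, ENNReal.toReal_ofReal (gammaPDFReal_nonneg ha (by norm_num : (0:ℝ) < 1 / 2) x)]
    rcases lt_or_gt_of_ne hx with h | h
    · simp [gammaPDFReal, not_le.2 h, not_lt.2 h.le]
    · simp only [gammaPDFReal, h.le, Set.mem_Ioi, h, Set.indicator_of_mem, if_true, smul_eq_mul, id]
      rw [mul_assoc, mul_assoc, ← Real.exp_add]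
      congr 3
      ring
  rw [e1, integral_const_mul]
  rcases lt_or_ge t (1 / 2) with ht | ht
  · rw [Real.integral_rpow_mul_exp_neg_mul_Ioi ha (by linarith)]
    have h2 : (0 : ℝ) < 1 / 2 - t := by linarith
    rw [Real.sqrt_eq_rpow, ← Real.rpow_natCast, ← Real.rpow_mul (by positivity),
      show (1 / 2 : ℝ) * k = a by rw [hadef]; ring, Real.div_rpow (by norm_num) h2.le,
      Real.div_rpow (by norm_num) h2.le, Real.one_rpow]
    field_simp
  · rw [integral_undef, mul_zero, Real.sqrt_eq_zero_of_nonpos, zero_pow hk.ne']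
    · apply div_nonpos_of_nonneg_of_nonpos <;> linarith
    · intro hI
      refine not_integrableOn_Ioi_rpow (a - 1) ?_
      refine Integrable.mono hI (by fun_prop) ?_
      filter_upwards [ae_restrict_mem measurableSet_Ioi] with x hx
      have hx : 0 < x := hx
      rw [norm_mul]
      apply le_mul_of_one_le_right (norm_nonneg _)
      rw [Real.norm_eq_abs, Real.abs_exp, Real.one_le_exp_iff]
      nlinarith

lemma iw_mgf_sum (k : ℕ) (t : ℝ) :
    mgf (fun x : Fin k → ℝ => ∑ i, x i ^ 2) (Measure.pi fun _ => gaussianReal 0 1) t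
      = √((1 / 2) / (1 / 2 - t)) ^ k := by
  have h := iIndepFun_pi (ι := Fin k) (μ := fun _ => gaussianReal 0 1)
    (X := fun _ (x : ℝ) => x ^ 2) (fun i => by fun_prop)
  have h2 := h.mgf_sum (t := t) (fun i => by fun_prop) Finset.univ
  have e : (fun x : Fin k → ℝ => ∑ i, x i ^ 2) = ∑ i, (fun ω : Fin k → ℝ => ω i ^ 2) := by
    ext x; simp
  rw [e, h2]
  have : ∀ i : Fin k, mgf (fun ω : Fin k → ℝ => ω i ^ 2) (Measure.pi fun _ => gaussianReal 0 1) t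
      = √((1 / 2) / (1 / 2 - t)) := by
    intro i
    rw [← iw_mgf_sq, mgf, mgf]
    have hp := measurePreserving_eval (fun _ : Fin k => gaussianReal 0 1) i
    conv_rhs => rw [← hp.map_eq]
    rw [integral_map hp.measurable.aemeasurable (by fun_prop)]
  rw [Finset.prod_congr rfl (fun i _ => this i)]
  rw [Finset.prod_const, Finset.card_univ, Fintype.card_fin]

lemma iw_chiSq (k : ℕ) (hk : 0 < k) :
    (Measure.pi fun _ : Fin k => gaussianReal 0 1).map (fun x => ∑ i, x i ^ 2)
      = gammaMeasure ((k : ℝ) / 2) (1 / 2) := by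
  have ha : 0 < (k : ℝ) / 2 := by positivity
  have := isProbabilityMeasure_gammaMeasure ha (by norm_num : (0 : ℝ) < 1 / 2)
  have hm : Measurable (fun x : Fin k → ℝ => ∑ i, x i ^ 2) := by fun_prop
  have : IsProbabilityMeasure ((Measure.pi fun _ : Fin k => gaussianReal 0 1).map
    (fun x => ∑ i, x i ^ 2)) := Measure.isProbabilityMeasure_map hm.aemeasurable
  have hmgf : mgf id ((Measure.pi fun _ : Fin k => gaussianReal 0 1).map
      (fun x => ∑ i, x i ^ 2)) = mgf id (gammaMeasure ((k : ℝ) / 2) (1 / 2)) := by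
    rw [mgf_id_map hm.aemeasurable]
    ext t
    rw [iw_mgf_gamma k hk, iw_mgf_sum]
  have key := eqOn_complexMGF_of_mgf hmgf
  have h0 : (0 : ℝ) ∈ interior (integrableExpSet id
      ((Measure.pi fun _ : Fin k => gaussianReal 0 1).map (fun x => ∑ i, x i ^ 2))) := by
    rw [mem_interior_iff_mem_nhds]
    filter_upwards [Iio_mem_nhds (by norm_num : (0 : ℝ) < 1 / 2)] with t ht
    have ht : t < 1 / 2 := ht
    have h2 : (0 : ℝ) < 1 / 2 - t := by linarith
    rw [integrableExpSet, Set.mem_ofPred_eq, ← mgf_pos_iff, hmgf, iw_mgf_gamma k hk]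
    positivity
  apply Measure.ext_of_charFun
  ext t
  rw [← complexMGF_id_mul_I, ← complexMGF_id_mul_I]
  apply key
  simpa using h0

lemma iw_inv_gram {E : Type*} [NormedAddCommGroup E] [InnerProductSpace ℝ E]
    [FiniteDimensional ℝ E] {m : ℕ} (x : E) (c : Fin m → E)
    (hc : LinearIndependent ℝ (Fin.cons x c : Fin (m + 1) → E)) :
    ((gram ℝ (Fin.cons x c : Fin (m + 1) → E))⁻¹) 0 0
      = 1 / ‖(Submodule.span ℝ (Set.range c))ᗮ.orthogonalProjectionOnto x‖ ^ 2 := by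
  set K := Submodule.span ℝ (Set.range c) with hK
  set v : Fin (m + 1) → E := Fin.cons x c with hv
  have hdet : IsUnit (gram ℝ v).det :=
    (det_gram_ne_zero_iff_linearIndependent.2 hc).isUnit
  obtain ⟨hc1, hx⟩ := linearIndependent_finCons.1 hc
  obtain ⟨a, ha⟩ := (Submodule.mem_span_range_iff_exists_fun ℝ).1
    (K.starProjection_apply_mem x)
  set z : E := x - K.starProjection x with hz
  have hzm : z ∈ Kᗮ := K.sub_starProjection_mem_orthogonal x
  have hz0 : z ≠ 0 := by
    intro h
    apply hx
    rw [sub_eq_zero.1 h]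
    exact K.starProjection_apply_mem x
  have hnz : ‖z‖ ^ 2 ≠ 0 := by positivity
  have hproj : ‖Kᗮ.orthogonalProjectionOnto x‖ = ‖z‖ := by
    rw [Submodule.coe_norm, ← Submodule.starProjection_apply,
      Submodule.starProjection_orthogonal_val]
  rw [hproj]
  set w : Fin (m + 1) → ℝ := (1 / ‖z‖ ^ 2) • (Fin.cons 1 (-a) : Fin (m + 1) → ℝ) with hw
  have hsum : ∑ j, w j • v j = (1 / ‖z‖ ^ 2) • z := by
    simp only [hw, Pi.smul_apply, smul_assoc, ← Finset.smul_sum]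
    congr 1
    rw [Fin.sum_univ_succ]
    simp [hv, hz, ← ha, sub_eq_add_neg]
  have hGw : gram ℝ v *ᵥ w = Pi.single 0 1 := by
    ext i
    have : (gram ℝ v *ᵥ w) i = inner ℝ (v i) (∑ j, w j • v j) := by
      simp [mulVec, dotProduct, inner_sum, inner_smul_right, mul_comm]
    rw [this, hsum, inner_smul_right]
    refine Fin.cases ?_ (fun j => ?_) i
    · have hxz : inner ℝ (v 0) z = ‖z‖ ^ 2 := by
        have h1 : v 0 = z + K.starProjection x := by simp [hv, hz]
        rw [h1, inner_add_left, real_inner_self_eq_norm_sq,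
          hzm _ (K.starProjection_apply_mem x), add_zero]
      rw [hxz, Pi.single_eq_same]
      field_simp
    · have : inner ℝ (v j.succ) z = 0 :=
        hzm _ (Submodule.subset_span ⟨j, by simp [hv]⟩)
      rw [this]
      simp
  have h2 : w = (gram ℝ v)⁻¹ *ᵥ Pi.single 0 1 := by
    rw [← hGw, mulVec_mulVec, nonsing_inv_mul _ hdet, one_mulVec]
  have h3 := congrFun h2 0
  rw [mulVec_single_one] at h3
  simpa [hw] using h3.symm

lemma iw_proj_law {E : Type*} [NormedAddCommGroup E] [InnerProductSpace ℝ E]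
    [FiniteDimensional ℝ E] [MeasurableSpace E] [BorelSpace E] (K : Submodule ℝ E) :
    (stdGaussian E).map K.orthogonalProjectionOnto = stdGaussian K := by
  apply Measure.ext_of_charFun
  ext t
  rw [charFun_stdGaussian, charFun_apply, integral_map (by fun_prop) (by fun_prop)]
  have : ∀ x : E, inner ℝ (K.orthogonalProjectionOnto x) t = inner ℝ x (t : E) := by
    intro x
    rw [Submodule.inner_orthogonalProjectionOnto_eq_of_mem_right]
  simp_rw [this]
  rw [← charFun_apply, charFun_stdGaussian]
  simp

lemma iw_normSq_law (F : Type*) [NormedAddCommGroup F] [InnerProductSpace ℝ F]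
    [FiniteDimensional ℝ F] [MeasurableSpace F] [BorelSpace F]
    (hF : 0 < Module.finrank ℝ F) :
    (stdGaussian F).map (fun x => ‖x‖ ^ 2)
      = gammaMeasure ((Module.finrank ℝ F : ℝ) / 2) (1 / 2) := by
  rw [← iw_chiSq _ hF, stdGaussian_eq_map_pi_orthonormalBasis (stdOrthonormalBasis ℝ F),
    Measure.map_map (by fun_prop) (by fun_prop)]
  congr 1
  ext x
  simp only [Function.comp]
  rw [← real_inner_self_eq_norm_sq, (stdOrthonormalBasis ℝ F).orthonormal.inner_sum]
  simp [sq]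

lemma iw_fixed_law {n m : ℕ} (hm : m < n) (c : Fin m → EuclideanSpace ℝ (Fin n))
    (hc : LinearIndependent ℝ c) :
    (stdGaussian (EuclideanSpace ℝ (Fin n))).map (fun x =>
      1 / ‖(Submodule.span ℝ (Set.range c))ᗮ.orthogonalProjectionOnto x‖ ^ 2)
      = Measure.map (fun u : ℝ => 1 / u)
          (gammaMeasure (((n : ℝ) - m) / 2) (1 / 2)) := by
  set K := Submodule.span ℝ (Set.range c) with hK
  have hr : Module.finrank ℝ K = m := by
    rw [hK, finrank_span_eq_card hc, Fintype.card_fin]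
  have hr2 : Module.finrank ℝ Kᗮ = n - m := by
    have := K.finrank_add_finrank_orthogonal
    rw [hr, finrank_euclideanSpace_fin] at this
    omega
  have h := iw_normSq_law Kᗮ (by omega)
  rw [hr2, Nat.cast_sub hm.le] at h
  rw [← h, ← iw_proj_law, Measure.map_map (by fun_prop) (by fun_prop),
    Measure.map_map (by fun_prop) (by fun_prop)]
  rfl

lemma iw_ac (n : ℕ) (K : Submodule ℝ (EuclideanSpace ℝ (Fin n))) (hK : K ≠ ⊤) :
    ∀ᵐ x ∂(stdGaussian (EuclideanSpace ℝ (Fin n))), x ∉ K := by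
  have hpos : 0 < Module.finrank ℝ Kᗮ := by
    rw [Module.finrank_pos_iff, Submodule.nontrivial_iff_ne_bot]
    intro h
    exact hK ((Submodule.orthogonal_eq_bot_iff).1 h)
  have h := iw_normSq_law Kᗮ hpos
  rw [← iw_proj_law, Measure.map_map (by fun_prop) (by fun_prop)] at h
  have h0 : gammaMeasure ((Module.finrank ℝ Kᗮ : ℝ) / 2) (1 / 2) {0} = 0 :=
    withDensity_absolutelyContinuous _ _ (by simp)
  rw [← h, Measure.map_apply (by fun_prop) (measurableSet_singleton _)] at h0
  rw [ae_iff]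
  refine measure_mono_null (fun x hx => ?_) h0
  have hx : x ∈ K := by simpa using hx
  have : Kᗮ.orthogonalProjectionOnto x = 0 := by
    rw [Submodule.orthogonalProjectionOnto_eq_zero_iff]
    simpa using hx
  simp [this]

lemma iw_swap (n d : ℕ) (μ : Measure ℝ) [IsProbabilityMeasure μ] :
    (Measure.pi fun _ : Fin n => Measure.pi fun _ : Fin d => μ).map (fun Y j i => Y i j)
      = Measure.pi fun _ : Fin d => Measure.pi fun _ : Fin n => μ := by
  have h1 : ∀ a b : ℕ, (Measure.pi fun _ : Fin a × Fin b => μ).map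
      (fun f (i : Fin a) (j : Fin b) => f (i, j))
      = Measure.pi fun _ : Fin a => Measure.pi fun _ : Fin b => μ := by
    intro a b
    have := Measure.infinitePi_map_curry (ι := Fin a) (κ := Fin b) (fun _ _ => μ)
    simp only [Measure.infinitePi_eq_pi] at this
    rw [← this]
    rfl
  have h2 := Measure.pi_map_piCongrLeft (Equiv.prodComm (Fin n) (Fin d))
    (β := fun _ => ℝ) (fun _ => μ)
  rw [← h1 n d, ← h1 d n, ← h2, Measure.map_map (by fun_prop) (by fun_prop),
    Measure.map_map (by fun_prop) (by fun_prop)]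
  rfl

lemma iw_cols (n d : ℕ) :
    (stdGaussianSample n d).map (fun Y (j : Fin d) => WithLp.toLp 2 (fun i => Y i j))
      = Measure.pi fun _ : Fin d => stdGaussian (EuclideanSpace ℝ (Fin n)) := by
  have h := Measure.pi_map_pi (ι := Fin d)
    (μ := fun _ => Measure.pi fun _ : Fin n => gaussianReal 0 1)
    (f := fun _ x => WithLp.toLp 2 x) (fun i => by fun_prop)
  rw [map_pi_eq_stdGaussian] at h
  rw [← h, ← iw_swap n d (gaussianReal 0 1), Measure.map_map (by fun_prop) (by fun_prop)]
  rfl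

lemma iw_wishart (n d : ℕ) (Y : Fin n → Fin d → ℝ) :
    wishart n d Y = gram ℝ (fun j : Fin d =>
      (WithLp.toLp 2 (fun i => Y i j) : EuclideanSpace ℝ (Fin n))) := by
  ext a b
  simp [wishart, Matrix.sum_apply, vecMulVec_apply, PiLp.inner_apply, mul_comm]

lemma iw_continuous_gram (n d : ℕ) :
    Continuous (fun v : Fin d → EuclideanSpace ℝ (Fin n) => gram ℝ v) := by
  refine continuous_matrix (fun i j => ?_)
  simp only [gram_apply]
  fun_prop

lemma iw_measurable_inv (n d : ℕ) (k : Fin d) :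
    Measurable (fun v : Fin d → EuclideanSpace ℝ (Fin n) => ((gram ℝ v)⁻¹) k k) := by
  have hc := iw_continuous_gram n d
  have h1 : Measurable (fun v : Fin d → EuclideanSpace ℝ (Fin n) => (gram ℝ v).det) :=
    hc.matrix_det.measurable
  have h2 : Measurable (fun v : Fin d → EuclideanSpace ℝ (Fin n) => (gram ℝ v).adjugate k k) :=
    (hc.matrix_adjugate.matrix_elem k k).measurable
  simp only [inv_def, Ring.inverse_eq_inv', Matrix.smul_apply, smul_eq_mul]
  exact h1.inv.mul h2

lemma iw_measurable_cons (n m : ℕ) :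
    Measurable (fun p : EuclideanSpace ℝ (Fin n) × (Fin m → EuclideanSpace ℝ (Fin n)) =>
      (Fin.cons p.1 p.2 : Fin (m + 1) → EuclideanSpace ℝ (Fin n))) := by
  refine measurable_pi_iff.2 (fun i => ?_)
  refine Fin.cases ?_ (fun j => ?_) i
  · simpa using measurable_fst
  · simp only [Fin.cons_succ]; fun_prop

lemma iw_split (n m : ℕ) :
    (Measure.pi fun _ : Fin (m + 1) => stdGaussian (EuclideanSpace ℝ (Fin n)))
      = ((stdGaussian (EuclideanSpace ℝ (Fin n))).prod
          (Measure.pi fun _ : Fin m => stdGaussian (EuclideanSpace ℝ (Fin n)))).map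
          (fun p => (Fin.cons p.1 p.2 : Fin (m + 1) → EuclideanSpace ℝ (Fin n))) := by
  have h := (measurePreserving_piFinSuccAbove
    (fun _ : Fin (m + 1) => stdGaussian (EuclideanSpace ℝ (Fin n))) 0).symm
  rw [← h.map_eq]
  congr 1
  ext p i
  simp [MeasurableEquiv.piFinSuccAbove, Fin.insertNthEquiv]

lemma iw_cons_ae {n m : ℕ} (hm : m < n) (c : Fin m → EuclideanSpace ℝ (Fin n))
    (hc : LinearIndependent ℝ c) :
    ∀ᵐ x ∂(stdGaussian (EuclideanSpace ℝ (Fin n))),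
      LinearIndependent ℝ (Fin.cons x c : Fin (m + 1) → EuclideanSpace ℝ (Fin n)) := by
  have hne : Submodule.span ℝ (Set.range c) ≠ ⊤ := by
    intro h
    have h1 := finrank_span_eq_card hc
    rw [h, finrank_top, finrank_euclideanSpace_fin, Fintype.card_fin] at h1
    omega
  filter_upwards [iw_ac n _ hne] with x hx
  exact linearIndependent_finCons.2 ⟨hc, hx⟩

lemma iw_measurableSet_li (n m : ℕ) :
    MeasurableSet {v : Fin m → EuclideanSpace ℝ (Fin n) | LinearIndependent ℝ v} := by
  have : {v : Fin m → EuclideanSpace ℝ (Fin n) | LinearIndependent ℝ v}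
      = (fun v => (gram ℝ v).det) ⁻¹' {0}ᶜ := by
    ext v
    simp [← det_gram_ne_zero_iff_linearIndependent (𝕜 := ℝ)]
  rw [this]
  exact (iw_continuous_gram n m).matrix_det.measurable (measurableSet_singleton _).compl

lemma iw_li_ae (n m : ℕ) (hm : m ≤ n) :
    ∀ᵐ c ∂(Measure.pi fun _ : Fin m => stdGaussian (EuclideanSpace ℝ (Fin n))),
      LinearIndependent ℝ c := by
  induction m with
  | zero => exact Filter.Eventually.of_forall fun c => linearIndependent_empty_type
  | succ m ih =>
    have hs := iw_measurableSet_li n (m + 1)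
    have hp := iw_measurable_cons n m
    rw [iw_split, ae_map_iff hp.aemeasurable hs, ae_iff]
    change ((stdGaussian (EuclideanSpace ℝ (Fin n))).prod
      (Measure.pi fun _ : Fin m => stdGaussian (EuclideanSpace ℝ (Fin n))))
      ((fun p => (Fin.cons p.1 p.2 : Fin (m + 1) → EuclideanSpace ℝ (Fin n))) ⁻¹'
        {v | LinearIndependent ℝ v}ᶜ) = 0
    rw [Measure.prod_apply_symm (hp hs.compl)]
    rw [lintegral_eq_zero_iff' (measurable_measure_prodMk_right (hp hs.compl)).aemeasurable]
    filter_upwards [ih (by omega)] with c hc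
    exact iw_cons_ae (by omega) c hc

lemma iw_main (n m : ℕ) (hm : m < n) :
    (Measure.pi fun _ : Fin (m + 1) => stdGaussian (EuclideanSpace ℝ (Fin n))).map
      (fun v => ((gram ℝ v)⁻¹) 0 0)
      = Measure.map (fun u : ℝ => 1 / u)
          (gammaMeasure (((n : ℝ) - m) / 2) (1 / 2)) := by
  have hI := iw_measurable_inv n (m + 1) 0
  have hp := iw_measurable_cons n m
  rw [iw_split, Measure.map_map hI hp]
  ext s hs
  rw [Measure.map_apply (hI.comp hp) hs, Measure.prod_apply_symm ((hI.comp hp) hs)]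
  rw [lintegral_congr_ae (g := fun _ => Measure.map (fun u : ℝ => 1 / u)
          (gammaMeasure (((n : ℝ) - m) / 2) (1 / 2)) s), lintegral_const, measure_univ, mul_one]
  filter_upwards [iw_li_ae n m hm.le] with c hc
  rw [← iw_fixed_law hm c hc, Measure.map_apply (by fun_prop) hs]
  apply measure_congr
  filter_upwards [iw_cons_ae hm c hc] with x hx
  have := iw_inv_gram x c hx
  apply propext
  change ((gram ℝ (Fin.cons x c : Fin (m + 1) → _))⁻¹) 0 0 ∈ s ↔ _ ∈ s
  rw [this]

theorem inv_wishart_entry_law (d n : ℕ) (hd : 1 ≤ d) (hn : d ≤ n) :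
    Measure.map (fun Y => ((wishart n d Y)⁻¹) ⟨0, hd⟩ ⟨0, hd⟩) (stdGaussianSample n d)
      = Measure.map (fun u : ℝ => 1 / u)
          (gammaMeasure (((n : ℝ) - d + 1) / 2) (1 / 2)) := by
  obtain ⟨m, rfl⟩ : ∃ m, d = m + 1 := ⟨d - 1, by omega⟩
  have h := iw_main n m (by omega)
  rw [← iw_cols, Measure.map_map (iw_measurable_inv n (m + 1) 0) (by fun_prop)] at h
  have e : ((n : ℝ) - ((m + 1 : ℕ) : ℝ) + 1) / 2 = ((n : ℝ) - m) / 2 := by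
    push_cast; ring
  rw [e, ← h]
  congr 1
  ext Y
  rw [iw_wishart]
  rfl
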